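/- Let m ≥ 4 and let ⟨1, c₂, c₃, …, c_m⟩ be a coin system. If the subsystem ⟨1, c₂, c₃⟩ is non-canonical, then the full coin system ⟨1, c₂, c₃, …, c_m⟩ is also non-canonical. -/

import Mathlib

/-- A coin system `⟨c 1, c 2, …, c m⟩` is a strictly increasing finite sequence of
positive integers with `c 1 = 1` (only the values `c i` for `1 ≤ i ≤ m` matter). -/
def IsCoinSystem (m : ℕ) (c : ℕ → ℕ) : Prop :=
  c 1 = 1 ∧ ∀ i j, 1 ≤ i → i < j → j ≤ m → c i < c j

/-- `α` is a representation of `x` under the coin system `⟨c 1, …, c m⟩`. -/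
def IsRepr (m : ℕ) (c : ℕ → ℕ) (x : ℕ) (α : ℕ → ℕ) : Prop :=
  ∑ i ∈ Finset.Icc 1 m, α i * c i = x

/-- The size of a representation, i.e. the total number of coins used. -/
def reprSize (m : ℕ) (α : ℕ → ℕ) : ℕ :=
  ∑ i ∈ Finset.Icc 1 m, α i

/-- `α` is the greedy representation of `x`: a representation such that for every
`2 ≤ i ≤ m` the part of the sum using coins smaller than `c i` is `< c i`. -/
def IsGreedy (m : ℕ) (c : ℕ → ℕ) (x : ℕ) (α : ℕ → ℕ) : Prop :=
  IsRepr m c x α ∧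
    ∀ i, 2 ≤ i → i ≤ m → ∑ j ∈ Finset.Icc 1 (i - 1), α j * c j < c i

/-- `α` is an optimal (minimum-size) representation of `x`. -/
def IsOpt (m : ℕ) (c : ℕ → ℕ) (x : ℕ) (α : ℕ → ℕ) : Prop :=
  IsRepr m c x α ∧ ∀ β, IsRepr m c x β → reprSize m α ≤ reprSize m β

/-- `x` is a counterexample: the greedy representation of `x` is strictly larger
than some representation of `x` (equivalently, than an optimal one). -/
def IsCounterexample (m : ℕ) (c : ℕ → ℕ) (x : ℕ) : Prop :=
  ∃ γ β, IsGreedy m c x γ ∧ IsRepr m c x β ∧ reprSize m β < reprSize m γ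

/-- A coin system is non-canonical if it has a counterexample. -/
def NonCanonical (m : ℕ) (c : ℕ → ℕ) : Prop :=
  ∃ x, IsCounterexample m c x

/-- A coin system is canonical if `|GRD(x)| = |OPT(x)|` for all `x`,
i.e. it has no counterexample. -/
def IsCanonical (m : ℕ) (c : ℕ → ℕ) : Prop :=
  ∀ x, ¬ IsCounterexample m c x

/-- A coin system is tight if it has no counterexample smaller than its largest coin. -/
def Tight (m : ℕ) (c : ℕ → ℕ) : Prop :=
  ∀ x, x < c m → ¬ IsCounterexample m c x

/-- `x` is the smallest counterexample of the coin system. -/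
def SmallestCounterexample (m : ℕ) (c : ℕ → ℕ) (x : ℕ) : Prop :=
  IsCounterexample m c x ∧ ∀ y, y < x → ¬ IsCounterexample m c y

theorem exists_isGreedy {m : ℕ} {c : ℕ → ℕ} (hm : 1 ≤ m) (hc : IsCoinSystem m c) (x : ℕ) :
    ∃ γ, IsGreedy m c x γ := by
  induction m, hm using Nat.le_induction generalizing x with
  | base =>
    refine ⟨fun _ => x, ?_, fun i h2 h1 => by omega⟩
    simp [IsRepr, hc.1]
  | succ m hm ih =>
    have hc' : IsCoinSystem m c := ⟨hc.1, fun i j h1 h2 h3 => hc.2 i j h1 h2 (by omega)⟩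
    obtain ⟨γ, hr, hg⟩ := ih hc' (x % c (m + 1))
    have hpos : 0 < c (m + 1) := by
      have := hc.2 1 (m + 1) le_rfl (by omega) le_rfl
      omega
    have hcongr : ∀ k ≤ m, ∑ j ∈ Finset.Icc 1 k, Function.update γ (m + 1) (x / c (m + 1)) j * c j =
        ∑ j ∈ Finset.Icc 1 k, γ j * c j := by
      intro k hk
      refine Finset.sum_congr rfl fun j hj => ?_
      rw [Finset.mem_Icc] at hj
      rw [Function.update_of_ne (by omega)]
    refine ⟨Function.update γ (m + 1) (x / c (m + 1)), ?_, ?_⟩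
    · unfold IsRepr at hr ⊢
      rw [Finset.sum_Icc_succ_top (by omega), hcongr m le_rfl, hr, Function.update_self]
      exact Nat.mod_add_div' x (c (m + 1))
    · intro i h2 hi
      rw [hcongr _ (by omega)]
      rcases Nat.lt_or_ge m i with h | h
      · obtain rfl : i = m + 1 := by omega
        have hr' : ∑ j ∈ Finset.Icc 1 m, γ j * c j = x % c (m + 1) := hr
        simpa [hr'] using Nat.mod_lt x hpos
      · exact hg i h2 h

theorem IsCoinSystem.le {m : ℕ} {c : ℕ → ℕ} (hc : IsCoinSystem m c) {i j : ℕ} (hi : 1 ≤ i)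
    (hij : i ≤ j) (hj : j ≤ m) : c i ≤ c j := by
  rcases hij.eq_or_lt with rfl | h
  · exact le_rfl
  · exact (hc.2 i j hi h hj).le

theorem sum_Icc_eq_of_eq_zero {k m : ℕ} (hkm : k ≤ m) {f : ℕ → ℕ}
    (hf : ∀ l, k < l → l ≤ m → f l = 0) :
    ∑ j ∈ Finset.Icc 1 m, f j = ∑ j ∈ Finset.Icc 1 k, f j := by
  symm
  refine Finset.sum_subset (Finset.Icc_subset_Icc_right hkm) fun l hl hl' => ?_
  simp only [Finset.mem_Icc] at hl hl'
  exact hf l (by omega) hl.2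

/-- A representation does not use the coins that exceed the amount. -/
theorem IsRepr.eq_zero {m : ℕ} {c : ℕ → ℕ} {x : ℕ} {α : ℕ → ℕ} (h : IsRepr m c x α) {l : ℕ}
    (h1 : 1 ≤ l) (hl : l ≤ m) (hx : x < c l) : α l = 0 := by
  by_contra h0
  have h2 : α l * c l ≤ ∑ i ∈ Finset.Icc 1 m, α i * c i :=
    Finset.single_le_sum (f := fun i => α i * c i) (fun _ _ => Nat.zero_le _)
      (Finset.mem_Icc.2 ⟨h1, hl⟩)
  unfold IsRepr at h
  have := Nat.le_mul_of_pos_left (c l) (Nat.pos_of_ne_zero h0)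
  omega

theorem IsRepr.eq_zero_or_coin {m : ℕ} {c : ℕ → ℕ} {x : ℕ} {α : ℕ → ℕ} (h : IsRepr m c x α)
    (hs : reprSize m α ≤ 1) : x = 0 ∨ ∃ l, 1 ≤ l ∧ l ≤ m ∧ x = c l := by
  unfold IsRepr at h
  unfold reprSize at hs
  by_cases hz : ∀ l ∈ Finset.Icc 1 m, α l = 0
  · left
    rw [← h]
    exact Finset.sum_eq_zero fun l hl => by simp [hz l hl]
  · push Not at hz
    obtain ⟨l, hl, h0⟩ := hz
    rw [← Finset.add_sum_erase _ _ hl] at hs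
    have h1 : ∑ i ∈ (Finset.Icc 1 m).erase l, α i = 0 := by omega
    have h2 : α l = 1 := by omega
    rw [Finset.sum_eq_zero_iff] at h1
    rw [← Finset.add_sum_erase _ _ hl,
      Finset.sum_eq_zero (s := (Finset.Icc 1 m).erase l) fun i hi => by simp [h1 i hi], h2] at h
    rw [Finset.mem_Icc] at hl
    exact .inr ⟨l, hl.1, hl.2, by omega⟩

/-- If the largest coin `c k` not exceeding `c i + c j` leaves a nonzero remainder that is not
a coin, then `c i + c j` is a counterexample. -/
theorem nonCanonical_of_add {m : ℕ} {c : ℕ → ℕ} (hc : IsCoinSystem m c) {i j k ρ : ℕ}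
    (hi : 1 ≤ i) (him : i ≤ m) (hj : 1 ≤ j) (hjm : j ≤ m) (hk : 2 ≤ k) (hkm : k ≤ m)
    (hsum : c i + c j = c k + ρ) (hnext : k < m → c i + c j < c (k + 1))
    (h0 : ρ ≠ 0) (hρ : ∀ l, 1 ≤ l → l ≤ m → ρ ≠ c l) : NonCanonical m c := by
  obtain ⟨γ, hr, hg⟩ := exists_isGreedy (by omega) hc (c i + c j)
  have himem : i ∈ Finset.Icc 1 m := Finset.mem_Icc.2 ⟨hi, him⟩
  have hjmem : j ∈ Finset.Icc 1 m := Finset.mem_Icc.2 ⟨hj, hjm⟩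
  have hkmem : k ∈ Finset.Icc 1 m := Finset.mem_Icc.2 ⟨by omega, hkm⟩
  refine ⟨c i + c j, γ, fun l => (if l = i then 1 else 0) + (if l = j then 1 else 0),
    ⟨hr, hg⟩, ?_, ?_⟩
  · simp [IsRepr, add_mul, Finset.sum_add_distrib, hi, him, hj, hjm]
  · have hβ : reprSize m (fun l => (if l = i then 1 else 0) + (if l = j then 1 else 0)) = 2 := by
      simp [reprSize, Finset.sum_add_distrib, hi, him, hj, hjm]
    rw [hβ]
    by_contra! hle
    have hzero : ∀ l, k < l → l ≤ m → γ l = 0 := fun l hkl hl =>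
      hr.eq_zero (by omega) hl
        (lt_of_lt_of_le (hnext (by omega)) (hc.le (by omega) (by omega) hl))
    have hγk : γ k ≠ 0 := by
      intro hz
      have h1 := hg k hk hkm
      have h2 : ∑ j ∈ Finset.Icc 1 m, γ j * c j = ∑ j ∈ Finset.Icc 1 (k - 1), γ j * c j := by
        refine sum_Icc_eq_of_eq_zero (by omega) fun l hl hlm => ?_
        rcases Nat.eq_or_lt_of_le (show k ≤ l by omega) with rfl | h
        · simp [hz]
        · simp [hzero l h hlm]
      unfold IsRepr at hr
      omega
    have hup : ∀ l ∈ (Finset.Icc 1 m).erase k, Function.update γ k (γ k - 1) l = γ l :=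
      fun l hl => Function.update_of_ne (Finset.ne_of_mem_erase hl) _ _
    have hrep : IsRepr m c ρ (Function.update γ k (γ k - 1)) := by
      unfold IsRepr at hr ⊢
      rw [← Finset.add_sum_erase _ _ hkmem] at hr ⊢
      rw [Finset.sum_congr rfl fun l hl => by rw [hup l hl], Function.update_self, Nat.sub_mul]
      have := Nat.le_mul_of_pos_left (c k) (Nat.pos_of_ne_zero hγk)
      omega
    have hsize : reprSize m (Function.update γ k (γ k - 1)) ≤ 1 := by
      have hle' : γ k + ((Finset.Icc 1 m).erase k).sum γ ≤ 2 :=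
        (Finset.add_sum_erase _ γ hkmem).trans_le hle
      rw [reprSize, ← Finset.add_sum_erase _ _ hkmem, Finset.sum_congr rfl hup,
        Function.update_self]
      omega
    rcases hrep.eq_zero_or_coin hsize with h | ⟨l, h1, h2, h3⟩
    · exact h0 h
    · exact hρ l h1 h2 h3

/-- The greedy algorithm is optimal for three coins `1, a, q * a + r` when `r = 0` or
`a ≤ q + r`. -/
theorem greedy_three_le {a q r g₁ g₂ g₃ b₁ b₂ b₃ : ℕ} (hq : 1 ≤ q) (hr : r < a)
    (hcan : r = 0 ∨ a ≤ q + r) (hg₁ : g₁ < a) (hg₂ : g₁ + g₂ * a < q * a + r)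
    (heq : g₁ + g₂ * a + g₃ * (q * a + r) = b₁ + b₂ * a + b₃ * (q * a + r)) :
    g₁ + g₂ + g₃ ≤ b₁ + b₂ + b₃ := by
  have hle : b₃ ≤ g₃ := by
    by_contra! h
    have := Nat.mul_le_mul_right (q * a + r) (show g₃ + 1 ≤ b₃ by omega)
    rw [add_mul] at this
    omega
  obtain ⟨D, rfl⟩ := Nat.exists_eq_add_of_le hle
  have hy : b₁ + b₂ * a = (g₁ + D * r) + (g₂ + D * q) * a := by
    linarith [heq, (by ring : (b₃ + D) * (q * a + r) =
      b₃ * (q * a + r) + D * r + D * q * a), add_mul g₂ (D * q) a]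
  have hdm := Nat.div_add_mod (g₁ + D * r) a
  obtain ⟨t, ht⟩ : ∃ t, t = (g₁ + D * r) / a := ⟨_, rfl⟩
  have hmod := Nat.mod_lt (g₁ + D * r) (show 0 < a by omega)
  generalize (g₁ + D * r) % a = s at hdm hmod
  rw [← ht] at hdm
  have hb₂ : b₂ ≤ g₂ + D * q + t := by
    by_contra! h
    have := Nat.mul_le_mul_right a (show g₂ + D * q + t + 1 ≤ b₂ by omega)
    nlinarith
  obtain ⟨u, hu⟩ := Nat.exists_eq_add_of_le hb₂
  have hb₁ : b₁ = s + u * a := by nlinarith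
  have hua : u ≤ u * a := Nat.le_mul_of_pos_right u (by omega)
  suffices h : g₁ + D ≤ s + t + D * q by omega
  rcases hcan with rfl | hcan
  · have : t = 0 := by rw [ht]; exact Nat.div_eq_of_lt (by simpa using hg₁)
    have : D ≤ D * q := Nat.le_mul_of_pos_right D hq
    simp only [mul_zero, add_zero] at hdm
    rw [‹t = 0›, mul_zero, zero_add] at hdm
    omega
  · have htD : t ≤ D := by
      by_contra! h
      have h1 := Nat.mul_le_mul_left a (show D + 1 ≤ t from h)
      have h2 := Nat.mul_le_mul_left D hr.le
      nlinarith
    obtain ⟨v, rfl⟩ := Nat.exists_eq_add_of_le htD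
    have h1 := Nat.mul_le_mul_left (t + v) hcan
    nlinarith

theorem NonCanonical.lt_of_three {c : ℕ → ℕ} (hc : IsCoinSystem 3 c) (h : NonCanonical 3 c) :
    0 < c 3 % c 2 ∧ c 3 / c 2 + c 3 % c 2 < c 2 := by
  obtain ⟨x, γ, β, ⟨hγ, hg⟩, hβ, hlt⟩ := h
  have h1 := hc.1
  have h12 := hc.2 1 2 (by norm_num) (by norm_num) (by norm_num)
  have h23 := hc.2 2 3 (by norm_num) (by norm_num) (by norm_num)
  have hg2 := hg 2 (by norm_num) (by norm_num)
  have hg3 := hg 3 (by norm_num) (by norm_num)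
  simp only [IsRepr, reprSize, Nat.reduceSub, Finset.sum_Icc_succ_top (show 1 ≤ 2 + 1 by norm_num),
    Finset.sum_Icc_succ_top (show 1 ≤ 1 + 1 by norm_num), Finset.Icc_self, Finset.sum_singleton,
    Nat.reduceAdd, h1, mul_one] at hγ hβ hlt hg2 hg3
  by_contra hcon
  have hdm := Nat.div_add_mod' (c 3) (c 2)
  have hq : 1 ≤ c 3 / c 2 := (Nat.one_le_div_iff (by omega)).2 h23.le
  refine absurd (greedy_three_le hq (Nat.mod_lt (c 3) (by omega)) ?_ hg2
    (by rwa [hdm]) (by rw [hdm, hγ, hβ])) (not_le.2 hlt)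
  omega

/-- If `⟨1, c 2, c 3⟩` is non-canonical, then `c 4` must not exceed the least multiple of
`c 2` above `c 3` for the full system to be canonical. -/
theorem nonCanonical_of_lt_fourth {m : ℕ} {c : ℕ → ℕ} (hm : 4 ≤ m) (hc : IsCoinSystem m c)
    {q r : ℕ} (hq : 1 ≤ q) (hr : 0 < r) (hqr : q + r < c 2) (h3 : c 3 = q * c 2 + r)
    (h4 : (q + 1) * c 2 < c 4) : NonCanonical m c := by
  obtain ⟨γ, hγ, hg⟩ := exists_isGreedy (by omega) hc ((q + 1) * c 2)
  refine ⟨(q + 1) * c 2, γ, fun l => if l = 2 then q + 1 else 0, ⟨hγ, hg⟩, ?_, ?_⟩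
  · simp [IsRepr]
    omega
  have hβ : reprSize m (fun l => if l = 2 then q + 1 else 0) = q + 1 := by
    simp [reprSize]
    omega
  have hzero : ∀ l, 3 < l → l ≤ m → γ l = 0 := fun l hkl hl =>
    hγ.eq_zero (by omega) hl (lt_of_lt_of_le h4 (hc.le (by omega) (by omega) hl))
  have hg2 := hg 2 (by norm_num) (by omega)
  have hg3 := hg 3 (by norm_num) (by omega)
  unfold IsRepr at hγ
  rw [hβ]
  unfold reprSize
  rw [sum_Icc_eq_of_eq_zero (show 3 ≤ m by omega) hzero]
  rw [sum_Icc_eq_of_eq_zero (show 3 ≤ m by omega) fun l h h' => by simp [hzero l h h']] at hγ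
  simp only [Nat.reduceSub, Finset.sum_Icc_succ_top (show 1 ≤ 2 + 1 by norm_num),
    Finset.sum_Icc_succ_top (show 1 ≤ 1 + 1 by norm_num), Finset.Icc_self, Finset.sum_singleton,
    Nat.reduceAdd, hc.1, mul_one] at hγ hg2 hg3 ⊢
  have hqa : c 2 ≤ q * c 2 := Nat.le_mul_of_pos_left _ hq
  rw [add_mul, one_mul] at hγ
  have hγ3 : γ 3 = 1 := by
    rcases Nat.lt_trichotomy (γ 3) 1 with h | h | h
    · rw [Nat.lt_one_iff.1 h] at hγ
      omega
    · exact h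
    · have := Nat.mul_le_mul_right (c 3) (show 2 ≤ γ 3 from h)
      omega
  rw [hγ3, one_mul] at hγ
  have hγ2 : γ 2 = 0 := by
    by_contra h
    have := Nat.le_mul_of_pos_left (c 2) (Nat.pos_of_ne_zero h)
    omega
  rw [hγ2, zero_mul] at hγ
  omega

/-- If the subsystem `⟨1, c 2, c 3⟩` is non-canonical, then for `m ≥ 4` the full
coin system `⟨1, c 2, …, c m⟩` is also non-canonical. -/
theorem stmt_8 (m : ℕ) (hm : 4 ≤ m) (c : ℕ → ℕ) (hc : IsCoinSystem m c)
    (h : NonCanonical 3 c) : NonCanonical m c := by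
  obtain ⟨hr, hqr⟩ := h.lt_of_three ⟨hc.1, fun i j h1 h2 h3 => hc.2 i j h1 h2 (by omega)⟩
  have h1 := hc.1
  have h12 := hc.2 1 2 (by norm_num) (by norm_num) (by omega)
  have h23 := hc.2 2 3 (by norm_num) (by norm_num) (by omega)
  have h34 := hc.2 3 4 (by norm_num) (by norm_num) (by omega)
  have h3 := (Nat.div_add_mod' (c 3) (c 2)).symm
  have hq : 1 ≤ c 3 / c 2 := (Nat.one_le_div_iff (by omega)).2 h23.le
  generalize c 3 / c 2 = q at *
  generalize c 3 % c 2 = r at *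
  by_contra hcan
  have h4 : c 4 + r ≤ c 3 + c 2 := by
    by_contra! hlt
    exact hcan (nonCanonical_of_lt_fourth hm hc hq hr hqr h3 (by rw [add_mul]; omega))
  have hcoin : ∀ ρ, ρ < c 3 → ρ ≠ 1 → ρ ≠ c 2 → ∀ l, 1 ≤ l → l ≤ m → ρ ≠ c l := by
    rintro ρ hρ hρ1 hρ2 l hl hlm rfl
    rcases Nat.lt_or_ge l 3 with h | h
    · interval_cases l
      · exact hρ1 h1
      · exact hρ2 rfl
    · exact absurd (hc.le (by omega) h hlm) (by omega)
  have hb1 : c 3 ≠ 2 * c 2 := by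
    intro h
    rcases (show q = 1 ∨ 2 ≤ q by omega) with rfl | h2
    · omega
    · have := Nat.mul_le_mul_right (c 2) h2
      omega
  have hb2 : c 3 + 1 ≠ 2 * c 2 := by
    intro h
    rcases (show q = 1 ∨ 2 ≤ q by omega) with rfl | h2
    · omega
    · have := Nat.mul_le_mul_right (c 2) h2
      omega
  have hstep : ∀ i, 3 ≤ i → i + 1 ≤ m → c (i + 1) + 2 ≤ c i + c 3 →
      i + 2 ≤ m ∧ c (i + 2) + 2 ≤ c (i + 1) + c 3 := by
    intro i hi him hgap
    by_contra! hcon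
    have hlt := hc.2 i (i + 1) (by omega) (by omega) him
    obtain ⟨e, he⟩ := Nat.exists_eq_add_of_lt hlt
    have key : ∀ j ρ, 2 ≤ j → j ≤ 4 → c i + c j = c (i + 1) + ρ → ρ + 2 ≤ c 3 → ρ ≠ 0 →
        ρ ≠ 1 → ρ ≠ c 2 → False := by
      intro j ρ hj hj4 hsum hρ h0 hρ1 hρ2
      refine hcan (nonCanonical_of_add hc (i := i) (j := j) (k := i + 1) (by omega) (by omega)
        (by omega) (by omega) (by omega) him hsum (fun hk => ?_) h0
        (hcoin ρ (by omega) hρ1 hρ2))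
      have := hcon (by omega)
      show _ < c (i + 2)
      omega
    rcases (show e = 0 ∨ 1 ≤ e by omega) with rfl | he1
    · exact key 2 (c 2 - 1) le_rfl (by omega) (by omega) (by omega) (by omega) (by omega)
        (by omega)
    by_cases hea : e + 1 + c 2 = c 3
    · rcases Nat.lt_or_ge (c 2) (e + 1) with hae | hae
      · exact key 4 (c 2 + (c 4 - c 3)) (by omega) le_rfl (by omega) (by omega) (by omega)
          (by omega) (by omega)
      · exact key 2 (c 2 - (e + 1)) le_rfl (by omega) (by omega) (by omega) (by omega) (by omega)
          (by omega)
    · exact key 3 (c 3 - (e + 1)) (by omega) (by omega) (by omega) (by omega) (by omega)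
        (by omega) (by omega)
  have hgap : ∀ i, 3 ≤ i → i + 1 ≤ m ∧ c (i + 1) + 2 ≤ c i + c 3 := by
    intro i hi
    induction i, hi using Nat.le_induction with
    | base => exact ⟨by omega, show c 4 + 2 ≤ _ by omega⟩
    | succ i hi ih => exact hstep i hi ih.1 ih.2
  have := (hgap m (by omega)).1
  omega
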